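/- Let ℱ be an 𝒩-saturated family of subsets of [n], let 𝒢 be a component of ℱ, and let M ∈ ℱ be such that B ⊆ M for every minimal element B of 𝒢 and M ⊆ A for every maximal element A of 𝒢, with M maximal with this property (no M' ∈ ℱ with M ⊊ M' satisfies the same containments). Then every X ∈ 𝒢 is comparable to M. -/

import Mathlib

variable {n : ℕ}

/-- Two subsets of `[n]` are incomparable if neither contains the other. -/
def Incomp (X Y : Finset (Fin n)) : Prop := ¬ X ⊆ Y ∧ ¬ Y ⊆ X

/-- `A, B, C, D` form an induced copy of the poset `𝒩`, with maximal elements `A, B`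
and minimal elements `C, D`: `C ⊂ A`, `D ⊂ A`, `D ⊂ B`, and the pairs `{A,B}`, `{C,B}`,
`{C,D}` are incomparable.  Here `A` is the maximal element comparable to both minimal
elements and `D` is the minimal element comparable to both maximal elements. -/
def IsNCopy (A B C D : Finset (Fin n)) : Prop :=
  C ⊂ A ∧ D ⊂ A ∧ D ⊂ B ∧ Incomp A B ∧ Incomp C B ∧ Incomp C D

/-- A family contains an induced copy of `𝒩` if four of its members form such a copy. -/
def ContainsN (F : Finset (Finset (Fin n))) : Prop :=
  ∃ A B C D, A ∈ F ∧ B ∈ F ∧ C ∈ F ∧ D ∈ F ∧ IsNCopy A B C D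

/-- `F` is `𝒩`-saturated: it contains no induced copy of `𝒩`, but adding any missing
subset of `[n]` creates one. -/
def NSaturated (F : Finset (Finset (Fin n))) : Prop :=
  ¬ ContainsN F ∧ ∀ S : Finset (Fin n), S ∉ F → ContainsN (insert S F)

/-- The comparability graph on `F \ {∅, [n]}`: two distinct members of `F`, both different
from `∅` and `[n]`, are adjacent whenever one is a subset of the other.  This graph has
the same connected components as the Hasse diagram of `F \ {∅, [n]}`. -/
def compGraph (F : Finset (Finset (Fin n))) : SimpleGraph (Finset (Fin n)) where
  Adj X Y := X ≠ Y ∧ X ∈ F ∧ Y ∈ F ∧ X ≠ ∅ ∧ X ≠ Finset.univ ∧ Y ≠ ∅ ∧ Y ≠ Finset.univ ∧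
    (X ⊆ Y ∨ Y ⊆ X)
  symm := by
    constructor
    rintro X Y ⟨h1, h2, h3, h4, h5, h6, h7, h8⟩
    exact ⟨h1.symm, h3, h2, h6, h7, h4, h5, h8.symm⟩
  loopless := ⟨fun X h => h.1 rfl⟩

/-- `G` is a component of `F`: the set of vertices reachable in the comparability graph
from some member of `F \ {∅, [n]}`. -/
def IsComponent (F : Finset (Finset (Fin n))) (G : Set (Finset (Fin n))) : Prop :=
  ∃ X₀, X₀ ∈ F ∧ X₀ ≠ ∅ ∧ X₀ ≠ Finset.univ ∧ G = {Y | (compGraph F).Reachable X₀ Y}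

/-- A maximal element of a component: a member not strictly contained in any member. -/
def IsMaxIn (G : Set (Finset (Fin n))) (T : Finset (Fin n)) : Prop :=
  T ∈ G ∧ ∀ Y ∈ G, ¬ T ⊂ Y

/-- A minimal element of a component: a member not strictly containing any member. -/
def IsMinIn (G : Set (Finset (Fin n))) (S : Finset (Fin n)) : Prop :=
  S ∈ G ∧ ∀ Y ∈ G, ¬ Y ⊂ S

/-- `X` lies above every minimal element of `G` and below every maximal element of `G`. -/
def IsMiddle (G : Set (Finset (Fin n))) (X : Finset (Fin n)) : Prop :=
  (∀ B, IsMinIn G B → B ⊆ X) ∧ (∀ A, IsMaxIn G A → X ⊆ A)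

lemma exists_isMinIn_subset {G : Set (Finset (Fin n))} {W : Finset (Fin n)} (hW : W ∈ G) :
    ∃ B, IsMinIn G B ∧ B ⊆ W := by
  obtain ⟨B, hBW, hB⟩ := (Set.toFinite G).exists_le_minimal hW
  exact ⟨B, ⟨hB.prop, fun Y hY h => hB.not_lt hY h⟩, hBW⟩

lemma exists_isMaxIn_superset {G : Set (Finset (Fin n))} {W : Finset (Fin n)} (hW : W ∈ G) :
    ∃ A, IsMaxIn G A ∧ W ⊆ A := by
  obtain ⟨A, hWA, hA⟩ := (Set.toFinite G).exists_le_maximal hW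
  exact ⟨A, ⟨hA.prop, fun Y hY h => hA.not_gt hY h⟩, hWA⟩

lemma IsMinIn.eq_of_subset {G : Set (Finset (Fin n))} {B Y : Finset (Fin n)} (hB : IsMinIn G B)
    (hY : Y ∈ G) (h : Y ⊆ B) : Y = B :=
  by_contra fun hne => hB.2 Y hY (h.ssubset_of_ne hne)

lemma IsMaxIn.eq_of_superset {G : Set (Finset (Fin n))} {A Y : Finset (Fin n)}
    (hA : IsMaxIn G A) (hY : Y ∈ G) (h : A ⊆ Y) : A = Y :=
  by_contra fun hne => hA.2 Y hY (h.ssubset_of_ne hne)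

/-- In an `𝒩`-free family, a member of `G` incomparable to a middle set is itself middle. -/
lemma IsMiddle.of_incomp {F : Finset (Finset (Fin n))} (hF : ¬ ContainsN F)
    {G : Set (Finset (Fin n))} (hGF : ∀ X ∈ G, X ∈ F) {Z W : Finset (Fin n)}
    (hZF : Z ∈ F) (hZ : IsMiddle G Z) (hW : W ∈ G) (hWZ : Incomp W Z) : IsMiddle G W := by
  obtain ⟨B₀, hB₀, hB₀W⟩ := exists_isMinIn_subset hW
  obtain ⟨A₀, hA₀, hWA₀⟩ := exists_isMaxIn_superset hW
  have hB₀Z := hZ.1 B₀ hB₀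
  have hZA₀ := hZ.2 A₀ hA₀
  refine ⟨fun B hB => ?_, fun A hA => ?_⟩
  · by_contra hBW
    have hBZ := hZ.1 B hB
    have hBB₀ : ¬ B₀ ⊆ B := fun h => hBW (hB.eq_of_subset hB₀.1 h ▸ hB₀W)
    refine hF ⟨Z, W, B, B₀, hZF, hGF W hW, hGF B hB.1, hGF B₀ hB₀.1,
      hBZ.ssubset_of_ne ?_, hB₀Z.ssubset_of_ne ?_, hB₀W.ssubset_of_ne ?_,
      ⟨hWZ.2, hWZ.1⟩, ⟨hBW, fun h => hWZ.1 (h.trans hBZ)⟩,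
      ⟨fun h => hBW (h.trans hB₀W), hBB₀⟩⟩
    · rintro rfl
      exact hBB₀ hB₀Z
    · rintro rfl
      exact hWZ.2 hB₀W
    · rintro rfl
      exact hWZ.1 hB₀Z
  · by_contra hWA
    have hZA := hZ.2 A hA
    have hAA₀ : ¬ A ⊆ A₀ := fun h => hWA ((hA.eq_of_superset hA₀.1 h).symm ▸ hWA₀)
    refine hF ⟨A₀, A, W, Z, hGF A₀ hA₀.1, hGF A hA.1, hGF W hW, hZF,
      hWA₀.ssubset_of_ne ?_, hZA₀.ssubset_of_ne ?_, hZA.ssubset_of_ne ?_,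
      ⟨fun h => hWA (hWA₀.trans h), hAA₀⟩, ⟨hWA, fun h => hWZ.2 (hZA.trans h)⟩, hWZ⟩
    · rintro rfl
      exact hWZ.2 hZA₀
    · rintro rfl
      exact hWZ.1 hWA₀
    · rintro rfl
      exact hAA₀ hZA₀

/-- Members of a component belong to the family and are different from `∅` and `[n]`. -/
lemma IsComponent.mem_prop {F : Finset (Finset (Fin n))} {G : Set (Finset (Fin n))}
    (hG : IsComponent F G) {X : Finset (Fin n)} (hX : X ∈ G) :
    X ∈ F ∧ X ≠ ∅ ∧ X ≠ Finset.univ := by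
  obtain ⟨X₀, h₁, h₂, h₃, rfl⟩ := hG
  obtain ⟨p⟩ := (show (compGraph F).Reachable X₀ X from hX).symm
  cases p with
  | nil => exact ⟨h₁, h₂, h₃⟩
  | cons h _ => exact ⟨h.2.1, h.2.2.2.1, h.2.2.2.2.1⟩

/-- A component is closed under comparability in `F \ {∅, [n]}`. -/
lemma IsComponent.mem_of_comparable {F : Finset (Finset (Fin n))} {G : Set (Finset (Fin n))}
    (hG : IsComponent F G) {X Y : Finset (Fin n)} (hX : X ∈ G) (hY : Y ∈ F) (hY₀ : Y ≠ ∅)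
    (hY₁ : Y ≠ Finset.univ) (h : X ⊆ Y ∨ Y ⊆ X) : Y ∈ G := by
  obtain ⟨hXF, hX₀, hX₁⟩ := hG.mem_prop hX
  by_cases hne : X = Y
  · exact hne ▸ hX
  obtain ⟨X₀, -, -, -, rfl⟩ := hG
  have hadj : (compGraph F).Adj X Y := ⟨hne, hXF, hY, hX₀, hX₁, hY₀, hY₁, h⟩
  exact SimpleGraph.Reachable.trans hX hadj.reachable

lemma Incomp.symm {X Y : Finset (Fin n)} (h : Incomp X Y) : Incomp Y X := ⟨h.2, h.1⟩

lemma Incomp.ne_empty {X Y : Finset (Fin n)} (h : Incomp X Y) : X ≠ ∅ := by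
  rintro rfl
  exact h.1 (Finset.empty_subset _)

lemma Incomp.ne_univ {X Y : Finset (Fin n)} (h : Incomp X Y) : X ≠ Finset.univ := by
  rintro rfl
  exact h.2 (Finset.subset_univ _)

lemma Incomp.ne {X Y : Finset (Fin n)} (h : Incomp X Y) : X ≠ Y := by
  rintro rfl
  exact h.1 subset_rfl

/-- If a set `S` is comparable to every member of a component `G`, and every member of
`F \ {∅, [n]}` comparable to `S` lies in `G`, then adding `S` to an `𝒩`-free family creates no
copy of `𝒩`. -/
lemma not_containsN_insert {F : Finset (Finset (Fin n))} (hF : ¬ ContainsN F)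
    {G : Set (Finset (Fin n))} (hG : IsComponent F G) {S : Finset (Fin n)}
    (hSG : ∀ Y ∈ F, Y ≠ ∅ → Y ≠ Finset.univ → S ⊆ Y ∨ Y ⊆ S → Y ∈ G)
    (hS : ∀ Y ∈ G, ¬ Incomp Y S) : ¬ ContainsN (insert S F) := by
  rintro ⟨A, B, C, D, hA, hB, hC, hD, hCA, hDA, hDB, hAB, hCB, hCD⟩
  have key : ∀ P Q, P ∈ insert S F → Q ∈ insert S F → (P ⊆ Q ∨ Q ⊆ P) →
      P ≠ S → P ≠ ∅ → P ≠ Finset.univ → (S ⊆ P ∨ P ⊆ S) →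
      Q ≠ ∅ → Q ≠ Finset.univ → ¬ Incomp Q S := by
    intro P Q hP hQ hPQ hPS hP₀ hP₁ hcomp hQ₀ hQ₁ hinc
    have hPF := Finset.mem_of_mem_insert_of_ne hP hPS
    have hQF := Finset.mem_of_mem_insert_of_ne hQ hinc.ne
    exact hS Q (hG.mem_of_comparable (hSG P hPF hP₀ hP₁ hcomp) hQF hQ₀ hQ₁ hPQ) hinc
  by_cases hAS : A = S
  · subst hAS
    exact key D B hD hB (.inl hDB.1) hDA.ne hCD.symm.ne_empty hCD.symm.ne_univ (.inr hDA.1)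
      hAB.symm.ne_empty hAB.symm.ne_univ hAB.symm
  by_cases hBS : B = S
  · subst hBS
    exact key D A hD hA (.inl hDA.1) hDB.ne hCD.symm.ne_empty hCD.symm.ne_univ (.inr hDB.1)
      hAB.ne_empty hAB.ne_univ hAB
  by_cases hCS : C = S
  · subst hCS
    exact key A D hA hD (.inr hDA.1) hAS hAB.ne_empty hAB.ne_univ (.inl hCA.1)
      hCD.symm.ne_empty hCD.symm.ne_univ hCD.symm
  by_cases hDS : D = S
  · subst hDS
    exact key A C hA hC (.inr hCA.1) hAS hAB.ne_empty hAB.ne_univ (.inl hDA.1)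
      hCD.ne_empty hCD.ne_univ hCD
  exact hF ⟨A, B, C, D, Finset.mem_of_mem_insert_of_ne hA hAS,
    Finset.mem_of_mem_insert_of_ne hB hBS, Finset.mem_of_mem_insert_of_ne hC hCS,
    Finset.mem_of_mem_insert_of_ne hD hDS, hCA, hDA, hDB, hAB, hCB, hCD⟩

/-- let `G` be a component of the `𝒩`-saturated family `F` and let `M ∈ F`
lie above every minimal element of `G` and below every maximal element of `G`, with `M`
maximal with this property.  Then every `X ∈ G` is comparable to `M`. -/
theorem stmt12 (n : ℕ) (F : Finset (Finset (Fin n))) (hF : NSaturated F)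
    (G : Set (Finset (Fin n))) (hG : IsComponent F G)
    (M : Finset (Fin n)) (hM : M ∈ F)
    (hmid : (∀ B, IsMinIn G B → B ⊆ M) ∧ (∀ A, IsMaxIn G A → M ⊆ A))
    (hmaximal : ∀ M' ∈ F, M ⊂ M' →
      ¬ ((∀ B, IsMinIn G B → B ⊆ M') ∧ (∀ A, IsMaxIn G A → M' ⊆ A))) :
    ∀ X ∈ G, X ⊆ M ∨ M ⊆ X := by
  classical
  intro X hX
  by_contra! hXM
  have hGF : ∀ Y ∈ G, Y ∈ F := fun Y hY => (hG.mem_prop hY).1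
  have hMmid : IsMiddle G M := hmid
  have hXmid : IsMiddle G X := hMmid.of_incomp hF.1 hGF hM hX hXM
  obtain ⟨B₀, hB₀, -⟩ := exists_isMinIn_subset hX
  obtain ⟨A₀, hA₀, -⟩ := exists_isMaxIn_superset hX
  have hXM' : Incomp M X := ⟨hXM.2, hXM.1⟩
  have hMG : M ∈ G :=
    hG.mem_of_comparable hB₀.1 hM hXM'.ne_empty hXM'.ne_univ (.inl (hMmid.1 B₀ hB₀))
  set S : Finset (Fin n) := (F.filter (IsMiddle G)).sup id with hSdef
  have hle : ∀ Y ∈ F, IsMiddle G Y → Y ⊆ S := fun Y hY hYm =>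
    Finset.le_sup (f := id) (Finset.mem_filter.2 ⟨hY, hYm⟩)
  have hSle : ∀ T, (∀ Y ∈ F, IsMiddle G Y → Y ⊆ T) → S ⊆ T := fun T hT =>
    Finset.sup_le fun Y hY => hT Y (Finset.mem_filter.1 hY).1 (Finset.mem_filter.1 hY).2
  have hMS : M ⊆ S := hle M hM hMmid
  have hSmid : IsMiddle G S :=
    ⟨fun B hB => (hMmid.1 B hB).trans hMS, fun A hA => hSle A fun Y _ hYm => hYm.2 A hA⟩
  have hMneS : M ≠ S := fun h => hXM.1 (h ▸ hle X (hGF X hX) hXmid)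
  have hSF : S ∉ F := fun h => hmaximal S h (hMS.ssubset_of_ne hMneS) hSmid
  refine not_containsN_insert hF.1 hG (S := S) ?_ ?_ (hF.2 S hSF)
  · rintro Y hY hY₀ hY₁ (h | h)
    · exact hG.mem_of_comparable hMG hY hY₀ hY₁ (.inl (hMS.trans h))
    · exact hG.mem_of_comparable hA₀.1 hY hY₀ hY₁ (.inr (h.trans (hSmid.2 A₀ hA₀)))
  · intro Y hY hYS
    refine hYS.2 (hSle Y fun Z hZ hZm => ?_)
    by_contra hZY
    refine hYS.1 (hle Y (hGF Y hY) (hZm.of_incomp hF.1 hGF hZ hY ⟨fun h => ?_, hZY⟩))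
    exact hYS.1 (h.trans (hle Z hZ hZm))
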